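/- If a compact Hausdorff topological space X is the image of the Sorgenfrey line under a continuous open surjection, then X is metrizable. -/

import Mathlib

open Set Filter Topology Function

/-- The Sorgenfrey line: the real line as a type synonym. -/
def SorgenfreyLine : Type := ℝ

notation "𝕊" => SorgenfreyLine

noncomputable instance : LinearOrder 𝕊 := inferInstanceAs (LinearOrder ℝ)
instance : RatCast 𝕊 := inferInstanceAs (RatCast ℝ)

/-- The topology on the Sorgenfrey line, generated by half-open intervals `[a, b)`, `a < b`. -/
instance : TopologicalSpace 𝕊 :=
  TopologicalSpace.generateFrom {s : Set 𝕊 | ∃ a b : 𝕊, a < b ∧ s = Set.Ico a b}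

/-- A set of reals is countable if near each of its points, on the right, all of its points are
isolated from the left. -/
theorem countable_of_eventually_isolated_left {Q : Set ℝ}
    (h : ∀ t ∈ Q, ∃ d > t, ∀ s ∈ Q, t < s → s < d → ∃ z < s, ∀ y ∈ Q, y < s → y ≤ z) :
    Q.Countable := by
  set L : Set ℝ := {s ∈ Q | ∃ z < s, ∀ y ∈ Q, y < s → y ≤ z}
  have hLc : L.Countable := countable_image_lt_image_Iio_within Q (id : ℝ → ℝ)
  have hRc := countable_image_lt_image_Ioi_within (Q \ L) (id : ℝ → ℝ)
  refine (hLc.union hRc).mono fun t ht => ?_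
  by_cases htL : t ∈ L
  · exact Or.inl htL
  obtain ⟨d, hd, hiso⟩ := h t ht
  refine Or.inr ⟨⟨ht, htL⟩, d, hd, fun s hs hts => ?_⟩
  by_contra! hsd
  exact hs.2 ⟨hs.1, hiso s hs.1 hts hsd⟩

section RightContinuousOpen

variable {X : Type*} [TopologicalSpace X] {f : ℝ → X}

/-- The points of `[q, r)` that are alone in their fibre over `[q, r)` form a countable set. -/
theorem countable_setOf_fibre_subsingleton [LocallyCompactSpace X]
    (hc : ∀ t U, IsOpen U → f t ∈ U → ∃ d > t, ∀ s ∈ Ico t d, f s ∈ U)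
    (ho : ∀ a b, IsOpen (f '' Ico a b)) (q r : ℝ) :
    {t ∈ Ico q r | ∀ s ∈ Ico q r, f s = f t → s = t}.Countable := by
  set Q := {t ∈ Ico q r | ∀ s ∈ Ico q r, f s = f t → s = t}
  refine countable_of_eventually_isolated_left fun t ht => ?_
  obtain ⟨K, hK, htK, hKsub⟩ := exists_compact_subset (ho q r) (mem_image_of_mem f ht.1)
  obtain ⟨d, hd, hdK⟩ := hc t _ isOpen_interior htK
  refine ⟨d, hd, fun s hs hts hsd => ?_⟩
  by_contra! hacc
  have hfreq : ∃ᶠ y in 𝓝[<] s, y ∈ Q := by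
    refine (nhdsLT_basis s).frequently_iff.2 fun z hz => ?_
    obtain ⟨y, hyQ, hys, hzy⟩ := hacc z hz
    exact ⟨y, ⟨hzy, hys⟩, hyQ⟩
  have hne : (𝓝[<] s ⊓ 𝓟 Q).NeBot := frequently_mem_iff_neBot.1 hfreq
  have hIoo : ∀ u < s, ∀ᶠ y in 𝓝[<] s ⊓ 𝓟 Q, y ∈ Q ∧ y ∈ Ioo u s := fun u hu => by
    filter_upwards [mem_inf_of_left (Ioo_mem_nhdsLT hu), mem_inf_of_right (mem_principal_self Q)]
      with y h1 h2 using ⟨h2, h1⟩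
  have hmap : map f (𝓝[<] s ⊓ 𝓟 Q) ≤ 𝓟 K := by
    refine le_principal_iff.2 (mem_map.2 ?_)
    filter_upwards [hIoo t hts] with y hy
    exact (interior_subset : interior K ⊆ K) (hdK y ⟨hy.2.1.le, hy.2.2.trans hsd⟩)
  obtain ⟨x, hxK, hx⟩ := hK hmap
  obtain ⟨u, hu, rfl⟩ := hKsub hxK
  have hcl : ∀ b > u, ∃ᶠ y in 𝓝[<] s ⊓ 𝓟 Q, f y ∈ f '' Ico u b := fun b hb =>
    MapClusterPt.frequently hx ((ho u b).mem_nhds (mem_image_of_mem f ⟨le_rfl, hb⟩))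
  rcases lt_or_ge u s with hus | hsu
  · obtain ⟨m, hum, hms⟩ := exists_between hus
    obtain ⟨y, ⟨v, hv, hvy⟩, hyQ, hy⟩ := ((hcl m hum).and_eventually (hIoo m hms)).exists
    have := hyQ.2 v ⟨hu.1.trans hv.1, hv.2.trans (hms.trans hs.1.2)⟩ hvy
    exact absurd (this ▸ hv.2) hy.1.not_gt
  · obtain ⟨y, ⟨v, hv, hvy⟩, hyQ, hy⟩ := ((hcl r hu.2).and_eventually (hIoo t hts)).exists
    have := hyQ.2 v ⟨hu.1.trans hv.1, hv.2⟩ hvy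
    exact absurd (hy.2.trans_le (hsu.trans (this ▸ hv.1))) (lt_irrefl _)

/-- A fibre without accumulation points from the right has an isolated point. -/
theorem exists_rat_Ico_fibre_eq_singleton [T1Space X]
    (hc : ∀ t U, IsOpen U → f t ∈ U → ∃ d > t, ∀ s ∈ Ico t d, f s ∈ U) (t₀ : ℝ)
    (hiso : ∀ t, f t = f t₀ → ∃ d > t, ∀ s ∈ Ioo t d, f s ≠ f t₀) :
    ∃ t, f t = f t₀ ∧ ∃ q r : ℚ, t ∈ Ico (q : ℝ) r ∧ ∀ s ∈ Ico (q : ℝ) r, f s = f t → s = t := by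
  obtain ⟨t, ht, z, hzt, hz⟩ : ∃ t, f t = f t₀ ∧ ∃ z < t, ∀ s ∈ Ioo z t, f s ≠ f t₀ := by
    by_cases hs : ∃ s < t₀, f s = f t₀
    · obtain ⟨s, hst, hs⟩ := hs
      obtain ⟨d, hd, hsd⟩ := hiso s hs
      set A : Set ℝ := {y | s < y ∧ f y = f t₀}
      have hAne : A.Nonempty := ⟨t₀, hst, rfl⟩
      have hAbdd : BddBelow A := ⟨s, fun y hy => hy.1.le⟩
      have hdA : d ≤ sInf A := le_csInf hAne fun y hy => by
        by_contra! hyd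
        exact hsd y ⟨hy.1, hyd⟩ hy.2
      refine ⟨sInf A, ?_, s, lt_of_lt_of_le hd hdA, fun y hy hfy =>
        (csInf_le hAbdd ⟨hy.1, hfy⟩).not_gt hy.2⟩
      by_contra hne
      obtain ⟨e, he, hse⟩ := hc (sInf A) {f t₀}ᶜ isOpen_compl_singleton hne
      obtain ⟨y, hyA, hye⟩ := exists_lt_of_csInf_lt hAne he
      exact hse y ⟨csInf_le hAbdd hyA, hye⟩ hyA.2
    · push Not at hs
      exact ⟨t₀, rfl, t₀ - 1, by linarith, fun s h => hs s h.2⟩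
  obtain ⟨d, hd, htd⟩ := hiso t ht
  obtain ⟨q, hzq, hqt⟩ := exists_rat_btwn hzt
  obtain ⟨r, htr, hrd⟩ := exists_rat_btwn hd
  refine ⟨t, ht, q, r, ⟨hqt.le, htr⟩, fun s hs hst => ?_⟩
  rcases lt_trichotomy s t with h | h | h
  · exact absurd (hst.trans ht) (hz s ⟨hzq.trans_le hs.1, h⟩)
  · exact h
  · exact absurd (hst.trans ht) (htd s ⟨h, hs.2.trans hrd⟩)

/-- The target of a right-continuous surjection from the reals that sends half-open intervals to
open sets is second countable, if it is locally compact and T1. -/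
theorem secondCountableTopology_of_rightContinuous_open [LocallyCompactSpace X] [T1Space X]
    (hc : ∀ t U, IsOpen U → f t ∈ U → ∃ d > t, ∀ s ∈ Ico t d, f s ∈ U)
    (ho : ∀ a b, IsOpen (f '' Ico a b)) (hsurj : Surjective f) :
    SecondCountableTopology X := by
  set T : Set ℝ := range ((↑) : ℚ → ℝ) ∪
    ⋃ (q : ℚ) (r : ℚ), {t ∈ Ico (q : ℝ) r | ∀ s ∈ Ico (q : ℝ) r, f s = f t → s = t}
  have hTc : T.Countable := (countable_range _).union <| countable_iUnion fun q =>
    countable_iUnion fun r => countable_setOf_fibre_subsingleton hc ho q r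
  refine TopologicalSpace.IsTopologicalBasis.secondCountableTopology
    (b := image2 (fun a b => f '' Ico a b) T T) ?_ (hTc.image2 hTc _)
  refine TopologicalSpace.isTopologicalBasis_of_isOpen_of_nhds ?_ fun x U hxU hU => ?_
  · rintro _ ⟨a, -, b, -, rfl⟩
    exact ho a b
  obtain ⟨t₀, rfl⟩ := hsurj x
  by_cases hiso : ∀ t, f t = f t₀ → ∃ d > t, ∀ s ∈ Ioo t d, f s ≠ f t₀
  · obtain ⟨t, ht, q, r, htqr⟩ := exists_rat_Ico_fibre_eq_singleton hc t₀ hiso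
    obtain ⟨d, hd, hdU⟩ := hc t U hU (ht ▸ hxU)
    obtain ⟨p, htp, hpd⟩ := exists_rat_btwn hd
    refine ⟨_, mem_image2_of_mem (Or.inr (mem_iUnion₂.2 ⟨q, r, htqr⟩)) (Or.inl ⟨p, rfl⟩),
      ⟨t, ⟨le_rfl, htp⟩, ht⟩, ?_⟩
    rintro _ ⟨s, hs, rfl⟩
    exact hdU s ⟨hs.1, hs.2.trans hpd⟩
  · push Not at hiso
    obtain ⟨t, ht, hacc⟩ := hiso
    obtain ⟨d, hd, hdU⟩ := hc t U hU (ht ▸ hxU)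
    obtain ⟨s, hs, hst⟩ := hacc d hd
    obtain ⟨q, htq, hqs⟩ := exists_rat_btwn hs.1
    obtain ⟨p, hsp, hpd⟩ := exists_rat_btwn hs.2
    refine ⟨_, mem_image2_of_mem (Or.inl ⟨q, rfl⟩) (Or.inl ⟨p, rfl⟩),
      ⟨s, ⟨hqs.le, hsp⟩, hst⟩, ?_⟩
    rintro _ ⟨y, hy, rfl⟩
    exact hdU y ⟨htq.le.trans hy.1, hy.2.trans hpd⟩

end RightContinuousOpen

/-- An open subset of the Sorgenfrey line contains a half-open interval to the right of each of
its points. -/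
theorem SorgenfreyLine.exists_Ico_subset {U : Set 𝕊} (hU : IsOpen U) {t : 𝕊} (ht : t ∈ U) :
    ∃ d > t, Ico t d ⊆ U := by
  induction hU with
  | basic s hs =>
    obtain ⟨a, b, -, rfl⟩ := hs
    exact ⟨b, ht.2, Ico_subset_Ico_left ht.1⟩
  | univ => exact ⟨(show ℝ from t) + 1, lt_add_one (show ℝ from t), subset_univ _⟩
  | inter s₁ s₂ _ _ ih₁ ih₂ =>
    obtain ⟨d₁, hd₁, h₁⟩ := ih₁ ht.1
    obtain ⟨d₂, hd₂, h₂⟩ := ih₂ ht.2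
    exact ⟨min d₁ d₂, lt_min hd₁ hd₂, fun y hy =>
      ⟨h₁ ⟨hy.1, hy.2.trans_le (min_le_left _ _)⟩, h₂ ⟨hy.1, hy.2.trans_le (min_le_right _ _)⟩⟩⟩
  | sUnion S _ ih =>
    obtain ⟨s, hs, hts⟩ := ht
    obtain ⟨d, hd, h⟩ := ih s hs hts
    exact ⟨d, hd, h.trans (subset_sUnion_of_mem hs)⟩

theorem SorgenfreyLine.isOpen_Ico (a b : 𝕊) : IsOpen (Ico a b) := by
  rcases lt_or_ge a b with h | h
  · exact TopologicalSpace.isOpen_generateFrom_of_mem ⟨a, b, h, rfl⟩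
  · rw [Ico_eq_empty h.not_gt]
    exact isOpen_empty

/-- A compact Hausdorff continuous open image of the Sorgenfrey line is metrizable. -/
theorem stmt5 {X : Type} [TopologicalSpace X] [CompactSpace X] [T2Space X] (f : 𝕊 → X)
    (hf : Continuous f) (hopen : IsOpenMap f) (hsurj : Surjective f) :
    TopologicalSpace.MetrizableSpace X := by
  have : SecondCountableTopology X :=
    secondCountableTopology_of_rightContinuous_open (f := f)
      (fun _ _ hU ht => SorgenfreyLine.exists_Ico_subset (hU.preimage hf) ht)
      (fun a b => hopen _ (SorgenfreyLine.isOpen_Ico a b)) hsurj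
  infer_instance
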